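/- arXiv:2510.15854 — 3 statements merged into one kernel-verified Lean document; each statement's English description precedes it below -/
import Mathlib

section
/- Let ρ, J, S, φ : ℝ × ℝ → ℝ be three times continuously differentiable functions of (x,t) satisfying, for all x ∈ ℝ and all t ≥ 0: (i) the continuity equation ∂_t ρ + ∂_x J = 0; (ii) the momentum equation ∂_t J + ∂_x S = ρ ∂_x φ; (iii) the quasi-neutral reformulated Poisson equation ∂_x(ρ ∂_x φ) = ∂_{xx} S. Then the quasi-neutral state holds for all times, i.e. ρ(x,t) = 1 and ∂_x J(x,t) = 0 for all x ∈ ℝ and t ≥ 0, if and only if the initial data are well prepared, i.e. ρ(x,0) = 1 and ∂_x J(x,0) = 0 for all x ∈ ℝ. -/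
/-- Spatial partial derivative of a function of `(x, t)`. -/
noncomputable def pdx (f : ℝ × ℝ → ℝ) (x t : ℝ) : ℝ := deriv (fun y => f (y, t)) x

/-- Temporal partial derivative of a function of `(x, t)`. -/
noncomputable def pdt (f : ℝ × ℝ → ℝ) (x t : ℝ) : ℝ := deriv (fun s => f (x, s)) t

/-- Second spatial partial derivative of a function of `(x, t)`. -/
noncomputable def pdxx (f : ℝ × ℝ → ℝ) (x t : ℝ) : ℝ := deriv (fun y => pdx f y t) x

lemma hasDerivAt_slice_fst {f : ℝ × ℝ → ℝ} (hf : Differentiable ℝ f) (x t : ℝ) :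
    HasDerivAt (fun y => f (y, t)) (fderiv ℝ f (x, t) (1, 0)) x :=
  (hf (x, t)).hasFDerivAt.comp_hasDerivAt x
    ((hasDerivAt_id x).prodMk (hasDerivAt_const x t))

lemma hasDerivAt_slice_snd {f : ℝ × ℝ → ℝ} (hf : Differentiable ℝ f) (x t : ℝ) :
    HasDerivAt (fun s => f (x, s)) (fderiv ℝ f (x, t) (0, 1)) t :=
  (hf (x, t)).hasFDerivAt.comp_hasDerivAt t
    ((hasDerivAt_const t x).prodMk (hasDerivAt_id t))

lemma pdx_eq_fderiv {f : ℝ × ℝ → ℝ} (hf : Differentiable ℝ f) (x t : ℝ) :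
    pdx f x t = fderiv ℝ f (x, t) (1, 0) :=
  (hasDerivAt_slice_fst hf x t).deriv

lemma pdt_eq_fderiv {f : ℝ × ℝ → ℝ} (hf : Differentiable ℝ f) (x t : ℝ) :
    pdt f x t = fderiv ℝ f (x, t) (0, 1) :=
  (hasDerivAt_slice_snd hf x t).deriv

lemma contDiff_pdx {f : ℝ × ℝ → ℝ} (hf : ContDiff ℝ 2 f) :
    ContDiff ℝ 1 (fun p : ℝ × ℝ => pdx f p.1 p.2) := by
  simp only [pdx_eq_fderiv (hf.differentiable (by norm_num))]
  exact (hf.fderiv_right (m := 1) (by norm_num)).clm_apply contDiff_const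

/-- Equality of mixed partial derivatives: the time derivative of `pdx f` is the space derivative
of `pdt f`. -/
lemma hasDerivAt_pdx_snd {f : ℝ × ℝ → ℝ} (hf : ContDiff ℝ 2 f) (x t : ℝ) :
    HasDerivAt (fun s => pdx f x s) (deriv (fun y => pdt f y t) x) t := by
  have hd : Differentiable ℝ f := hf.differentiable (by norm_num)
  have hd' : Differentiable ℝ (fderiv ℝ f) :=
    (hf.fderiv_right (m := 1) (by norm_num)).differentiable (by norm_num)
  have happ (v : ℝ × ℝ) (w : ℝ × ℝ) :
      fderiv ℝ (fun p => fderiv ℝ f p v) (x, t) w = fderiv ℝ (fderiv ℝ f) (x, t) w v := by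
    rw [((hd' (x, t)).hasFDerivAt.clm_apply (hasFDerivAt_const v (x, t))).fderiv]
    simp
  have hdv (v : ℝ × ℝ) : Differentiable ℝ (fun p => fderiv ℝ f p v) :=
    hd'.clm_apply (differentiable_const v)
  have hsymm : IsSymmSndFDerivAt ℝ f (x, t) :=
    hf.contDiffAt.isSymmSndFDerivAt (by simp)
  simp only [pdx_eq_fderiv hd, pdt_eq_fderiv hd]
  rw [(hasDerivAt_slice_fst (hdv (0, 1)) x t).deriv, happ, hsymm.eq, ← happ]
  exact hasDerivAt_slice_snd (hdv (1, 0)) x t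

lemma eq_initial_of_hasDerivAt_zero {g : ℝ → ℝ} (hg : ∀ t, 0 ≤ t → HasDerivAt g 0 t)
    {t : ℝ} (ht : 0 ≤ t) : g t = g 0 :=
  constant_of_has_deriv_right_zero
    (fun s hs => (hg s hs.1).continuousAt.continuousWithinAt)
    (fun s hs => (hg s hs.1).hasDerivWithinAt) t ⟨ht, le_rfl⟩

/-- Lemma 2.1: the reformulated quasi-neutral Vlasov–Poisson system `RP⁰` is
equivalent to the quasi-neutral system `P⁰` iff the initial data are well prepared. -/
theorem quasi_neutral_iff_well_prepared
    (ρ J S φ : ℝ × ℝ → ℝ)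
    (hρ : ContDiff ℝ 3 ρ) (hJ : ContDiff ℝ 3 J) (hS : ContDiff ℝ 3 S)
    (hφ : ContDiff ℝ 3 φ)
    (hcont : ∀ x t : ℝ, 0 ≤ t → pdt ρ x t + pdx J x t = 0)
    (hmom : ∀ x t : ℝ, 0 ≤ t → pdt J x t + pdx S x t = ρ (x, t) * pdx φ x t)
    (hpois : ∀ x t : ℝ, 0 ≤ t →
      pdx (fun p => ρ p * pdx φ p.1 p.2) x t = pdxx S x t) :
    (∀ x t : ℝ, 0 ≤ t → ρ (x, t) = 1 ∧ pdx J x t = 0) ↔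
      (∀ x : ℝ, ρ (x, 0) = 1 ∧ pdx J x 0 = 0) := by
  refine ⟨fun h x => h x 0 le_rfl, fun h => ?_⟩
  have hJ' : ContDiff ℝ 2 J := hJ.of_le (by norm_num)
  have hflux : ContDiff ℝ 1 (fun p : ℝ × ℝ => ρ p * pdx φ p.1 p.2) :=
    (hρ.of_le (by norm_num)).mul (contDiff_pdx (hφ.of_le (by norm_num)))
  have hSx : ContDiff ℝ 1 (fun p : ℝ × ℝ => pdx S p.1 p.2) :=
    contDiff_pdx (hS.of_le (by norm_num))
  have hmixed (x t : ℝ) (ht : 0 ≤ t) : deriv (fun y => pdt J y t) x = 0 := by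
    have hmom' : (fun y => pdt J y t) = fun y => ρ (y, t) * pdx φ y t - pdx S y t :=
      funext fun y => eq_sub_of_add_eq (hmom y t ht)
    have h₁ := (hasDerivAt_slice_fst (hflux.differentiable (by norm_num)) x t).differentiableAt
    have h₂ := (hasDerivAt_slice_fst (hSx.differentiable (by norm_num)) x t).differentiableAt
    rw [hmom']
    exact (deriv_fun_sub h₁ h₂).trans (sub_eq_zero.mpr (hpois x t ht))
  have hJx (x t : ℝ) (ht : 0 ≤ t) : pdx J x t = 0 :=
    (eq_initial_of_hasDerivAt_zero
      (fun s hs => hmixed x s hs ▸ hasDerivAt_pdx_snd hJ' x s) ht).trans (h x).2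
  intro x t ht
  refine ⟨?_, hJx x t ht⟩
  refine (eq_initial_of_hasDerivAt_zero (g := fun s => ρ (x, s)) (fun s hs => ?_) ht).trans (h x).1
  have hρt : pdt ρ x s = 0 := by simpa [hJx x s hs] using hcont x s hs
  have hd : Differentiable ℝ ρ := hρ.differentiable (by norm_num)
  rw [← hρt, pdt_eq_fderiv hd]
  exact hasDerivAt_slice_snd hd x s
end

section
/- Let h > 0, t ∈ ℝ, m = t + h/2, and let f : ℝ → ℝ be four times continuously differentiable on the interval [t, m] with |f''''(s)| ≤ M for all s ∈ [t, m]. Then the finite-difference combination used to approximate the second derivative satisfies | ( −24 f(m) + 24 f(t) + 8 h f'(m) + 4 h f'(t) ) / h² − f''(m) | ≤ (7/48) M h². -/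
/-- The Taylor-expansion estimate underlying Theorem 3.1: second-order accuracy
of the finite-difference approximation of `f''` at the midpoint `m = t + h/2`. -/
theorem second_derivative_fd_estimate
    (h t M : ℝ) (hh : 0 < h) (m : ℝ) (hm : m = t + h / 2)
    (f : ℝ → ℝ)
    (hf : ContDiffOn ℝ 4 f (Set.Icc t m))
    (hM : ∀ s ∈ Set.Icc t m, |iteratedDerivWithin 4 f (Set.Icc t m) s| ≤ M) :
    |(-24 * f m + 24 * f t + 8 * h * iteratedDerivWithin 1 f (Set.Icc t m) m +
        4 * h * iteratedDerivWithin 1 f (Set.Icc t m) t) / h ^ 2 -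
      iteratedDerivWithin 2 f (Set.Icc t m) m| ≤ 7 / 48 * M * h ^ 2 := by
  have htm : t < m := by linarith
  have hu : Set.uIcc m t = Set.Icc t m := Set.uIcc_of_ge htm.le
  have hud : UniqueDiffOn ℝ (Set.Icc t m) := uniqueDiffOn_Icc htm
  have hoo : Set.uIoo m t ⊆ Set.Icc t m := by
    rw [← hu]
    exact Set.uIoo_subset_uIcc_self
  have hg : ContDiffOn ℝ 3 (derivWithin f (Set.Icc t m)) (Set.Icc t m) :=
    hf.derivWithin hud (by norm_num)
  have hgi : ∀ n : ℕ, iteratedDerivWithin n (derivWithin f (Set.Icc t m)) (Set.Icc t m) =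
      iteratedDerivWithin (n + 1) f (Set.Icc t m) := fun n => by
    funext x
    rw [iteratedDerivWithin_succ']
  obtain ⟨ξ, hξ, hfξ⟩ := taylor_mean_remainder_lagrange (f := f) (n := 3) htm.ne'
    (by rw [hu]; exact hf.of_le (by norm_num))
    (by
      rw [hu]
      exact (hf.differentiableOn_iteratedDerivWithin (by norm_num) hud).mono hoo)
  obtain ⟨η, hη, hgη⟩ := taylor_mean_remainder_lagrange
    (f := derivWithin f (Set.Icc t m)) (n := 2) htm.ne'
    (by rw [hu]; exact hg.of_le (by norm_num))
    (by
      rw [hu]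
      exact (hg.differentiableOn_iteratedDerivWithin (by norm_num) hud).mono hoo)
  have hMξ := abs_le.mp (hM ξ (hoo hξ))
  have hMη := abs_le.mp (hM η (hoo hη))
  have htd : t - m = -(h / 2) := by linarith
  simp only [hu, taylorWithinEval_succ, taylor_within_zero_eval, hgi, htd, smul_eq_mul] at hfξ hgη
  norm_num [Nat.factorial] at hfξ hgη
  simp only [← iteratedDerivWithin_one] at hfξ hgη ⊢
  generalize iteratedDerivWithin 4 f (Set.Icc t m) ξ = a at *
  generalize iteratedDerivWithin 4 f (Set.Icc t m) η = b at *
  have key : (-24 * f m + 24 * f t + 8 * h * iteratedDerivWithin 1 f (Set.Icc t m) m +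
        4 * h * iteratedDerivWithin 1 f (Set.Icc t m) t) / h ^ 2 -
      iteratedDerivWithin 2 f (Set.Icc t m) m = (a / 16 - b / 12) * h ^ 2 := by
    field_simp
    linear_combination 192 * (24 * hfξ + 4 * h * hgη)
  rw [key, abs_mul, abs_of_pos (pow_pos hh 2)]
  gcongr
  rw [abs_le]
  constructor <;> linarith
end

section
/- Let λ > 0, h > 0, k ∈ ℝ, let B be the 4×4 complex matrix with rows (1, 0, 0, 0), (0, 1, −i k h, 0), (0, 0, 1, −h), (0, 0, h, λ²), and let A be the 4×4 complex matrix with rows (1, 0, 0, 0), (0, 1, 0, 0), (0, 0, 1, 0), (h, 0, 0, λ²). Then the set of eigenvalues of the amplification matrix B⁻¹A (its spectrum in ℂ) is exactly { 1, (λ² + i λ h)/(λ² + h²), (λ² − i λ h)/(λ² + h²) }. -/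
open Matrix Complex

/-- The matrix `B` of the von Neumann stability analysis (Theorem 4.3). -/
noncomputable def Bmat (lam h k : ℝ) : Matrix (Fin 4) (Fin 4) ℂ :=
  !![1, 0, 0, 0;
     0, 1, -(I * (k : ℂ) * (h : ℂ)), 0;
     0, 0, 1, -(h : ℂ);
     0, 0, (h : ℂ), (lam : ℂ) ^ 2]

/-- The matrix `A` of the von Neumann stability analysis (Theorem 4.3). -/
noncomputable def Amat (lam h : ℝ) : Matrix (Fin 4) (Fin 4) ℂ :=
  !![1, 0, 0, 0;
     0, 1, 0, 0;
     0, 0, 1, 0;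
     (h : ℂ), 0, 0, (lam : ℂ) ^ 2]

/-- The characteristic polynomial of the pencil `z B - A`. -/
theorem det_smul_Bmat_sub_Amat (lam h k : ℝ) (z : ℂ) :
    (z • Bmat lam h k - Amat lam h).det =
      (z - 1) ^ 2 * ((lam : ℂ) ^ 2 * (z - 1) ^ 2 + z ^ 2 * (h : ℂ) ^ 2) := by
  simp [Bmat, Amat, det_succ_row_zero, Fin.sum_univ_succ, Fin.succAbove]
  ring

theorem det_Bmat (lam h k : ℝ) :
    (Bmat lam h k).det = (lam : ℂ) ^ 2 + (h : ℂ) ^ 2 := by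
  simp [Bmat, det_succ_row_zero, Fin.sum_univ_succ, Fin.succAbove]
  ring

theorem mem_spectrum_inv_mul_iff {n K : Type*} [Fintype n] [DecidableEq n] [Field K]
    {B : Matrix n n K} (hB : IsUnit B.det) (A : Matrix n n K) (z : K) :
    z ∈ spectrum K (B⁻¹ * A) ↔ (z • B - A).det = 0 := by
  have hfac : algebraMap K (Matrix n n K) z - B⁻¹ * A = B⁻¹ * (z • B - A) := by
    rw [mul_sub, mul_smul_comm, nonsing_inv_mul B hB, Algebra.algebraMap_eq_smul_one]
  have hinv : B⁻¹.det ≠ 0 := (isUnit_nonsing_inv_det B hB).ne_zero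
  rw [spectrum.mem_iff, hfac, isUnit_iff_isUnit_det, det_mul, isUnit_iff_ne_zero, not_not,
    mul_eq_zero, or_iff_right hinv]

/-- The spectrum of the amplification matrix `B⁻¹A` is exactly
`{1, (λ² + iλh)/(λ² + h²), (λ² − iλh)/(λ² + h²)}`. -/
theorem spectrum_amplification_matrix (lam h k : ℝ) (hlam : 0 < lam) (hh : 0 < h) :
    spectrum ℂ ((Bmat lam h k)⁻¹ * Amat lam h) =
      {1, ((lam : ℂ) ^ 2 + I * (lam : ℂ) * (h : ℂ)) / ((lam : ℂ) ^ 2 + (h : ℂ) ^ 2),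
        ((lam : ℂ) ^ 2 - I * (lam : ℂ) * (h : ℂ)) / ((lam : ℂ) ^ 2 + (h : ℂ) ^ 2)} := by
  have hD : (lam : ℂ) ^ 2 + (h : ℂ) ^ 2 ≠ 0 := by
    exact_mod_cast (by positivity : lam ^ 2 + h ^ 2 ≠ 0)
  have hB : IsUnit (Bmat lam h k).det := by
    rw [det_Bmat]
    exact hD.isUnit
  ext z
  have hfac : (lam : ℂ) ^ 2 * (z - 1) ^ 2 + z ^ 2 * (h : ℂ) ^ 2 =
      ((lam : ℂ) ^ 2 + (h : ℂ) ^ 2) *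
        ((z - ((lam : ℂ) ^ 2 + I * (lam : ℂ) * (h : ℂ)) / ((lam : ℂ) ^ 2 + (h : ℂ) ^ 2)) *
        (z - ((lam : ℂ) ^ 2 - I * (lam : ℂ) * (h : ℂ)) / ((lam : ℂ) ^ 2 + (h : ℂ) ^ 2))) := by
    field_simp
    linear_combination (lam : ℂ) ^ 2 * (h : ℂ) ^ 2 * I_sq
  rw [mem_spectrum_inv_mul_iff hB, det_smul_Bmat_sub_Amat, hfac]
  simp [hD, sub_eq_zero]
end
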